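/- arXiv:1808.03932 — 2 statements merged into one kernel-verified Lean document; each statement's English description precedes it below -/
import Mathlib

section
/- Let G be a finite simple graph with nonempty vertex set X. Then the growth rate of the partially commutative monoid M(X,G) equals β(G): the sequence (m_n)^{1/n} converges as n → ∞, and its limit equals β(G). -/
noncomputable section

/-- The number of cliques of size `k` in `G` (the empty set is the unique clique of size 0). -/
def cliqueCount {V : Type*} [Fintype V] (G : SimpleGraph V) (k : ℕ) : ℕ :=
  Nat.card {s : Finset V // G.IsNClique k s}

/-- The clique number `ω(G)` of `G`. -/
def cliqueNum {V : Type*} [Fintype V] (G : SimpleGraph V) : ℕ :=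
  sSup {k : ℕ | ∃ s : Finset V, G.IsNClique k s}

/-- The PC-polynomial `PC(G,x) = ∑_{k=0}^{ω(G)} (-1)^k c_k(G) x^{ω(G)-k}`. -/
def PCpoly {V : Type*} [Fintype V] (G : SimpleGraph V) : Polynomial ℝ :=
  ∑ k ∈ Finset.range (cliqueNum G + 1),
    Polynomial.C ((-1 : ℝ) ^ k * (cliqueCount G k : ℝ)) * Polynomial.X ^ (cliqueNum G - k)

/-- `β(G)`, the largest real root of the PC-polynomial of `G`. -/
def beta {V : Type*} [Fintype V] (G : SimpleGraph V) : ℝ :=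
  sSup {x : ℝ | (PCpoly G).eval x = 0}

/-- The congruence on the free monoid on the vertices of `G` generated by the
relations `xy = yx` for every edge `(x,y)` of `G`. -/
def traceCon {V : Type*} (G : SimpleGraph V) : Con (FreeMonoid V) :=
  conGen (fun a b => ∃ x y : V, G.Adj x y ∧
    a = FreeMonoid.of x * FreeMonoid.of y ∧ b = FreeMonoid.of y * FreeMonoid.of x)

/-- `mcount G n` is the number of elements of the partially commutative monoid `M(X,G)`
of length `n`. -/
def mcount {V : Type*} [Fintype V] (G : SimpleGraph V) (n : ℕ) : ℕ :=
  Nat.card {q : (traceCon G).Quotient //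
    ∃ w : FreeMonoid V, w.length = n ∧ (traceCon G).mk' w = q}

namespace TraceMonoid

open FreeMonoid

variable {V : Type*} (G : SimpleGraph V)

/-- The partially commutative monoid `M(X,G)`. -/
abbrev Trace : Type _ := (traceCon G).Quotient

/-- The class of a letter. -/
def letter (a : V) : Trace G := (traceCon G).mk' (of a)

theorem letter_comm {a b : V} (h : G.Adj a b) :
    letter G a * letter G b = letter G b * letter G a :=
  (traceCon G).eq.2 (ConGen.Rel.of _ _ ⟨a, b, h, rfl, rfl⟩)

theorem trace_induction {p : Trace G → Prop} (one : p 1)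
    (letter_mul : ∀ a q, p q → p (letter G a * q)) (q : Trace G) : p q := by
  obtain ⟨w, rfl⟩ := (traceCon G).mk'_surjective q
  induction w using FreeMonoid.recOn with
  | one => simpa using one
  | of_mul a w ih => simpa [letter] using letter_mul a _ ih

/-- The length of a trace. -/
def len : Trace G →* Multiplicative ℕ :=
  (traceCon G).lift (FreeMonoid.lift fun _ => Multiplicative.ofAdd 1) <| by
    refine Con.conGen_le.2 ?_
    rintro _ _ ⟨x, y, -, rfl, rfl⟩
    simp [Con.ker_rel]

theorem len_mk (w : FreeMonoid V) :
    len G ((traceCon G).mk' w) = Multiplicative.ofAdd w.length := by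
  induction w using FreeMonoid.recOn with
  | one => simp
  | of_mul a w ih =>
    rw [map_mul, map_mul, ih, FreeMonoid.length_mul, ofAdd_add]
    rfl

theorem len_letter (a : V) : len G (letter G a) = Multiplicative.ofAdd 1 := len_mk G (of a)

open Classical in
/-- Left multiplication by a letter `b`, on pairs consisting of a trace and of the result
of cancelling `a` on the left of it (if possible). -/
def cancelStep (a b : V) : Function.End (Option (Trace G) × Trace G) := fun p =>
  (if a = b then some p.2 else if G.Adj a b then p.1.map (letter G b * ·) else none,
    letter G b * p.2)

theorem cancelStep_comm (a : V) {x y : V} (h : G.Adj x y) (p : Option (Trace G) × Trace G) :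
    cancelStep G a x (cancelStep G a y p) = cancelStep G a y (cancelStep G a x p) := by
  have hne := h.ne
  obtain ⟨s, q⟩ := p
  have hc : ∀ r, letter G x * (letter G y * r) = letter G y * (letter G x * r) := fun r => by
    rw [← mul_assoc, letter_comm G h, mul_assoc]
  by_cases hx : a = x
  · subst hx
    simp [cancelStep, hne, h, hc]
  · by_cases hy : a = y
    · subst hy
      simp [cancelStep, hx, h.symm, hc]
    · by_cases hax : G.Adj a x <;> by_cases hay : G.Adj a y <;>
        cases s <;> simp [cancelStep, hx, hy, hax, hay, hc]

/-- The action of traces generated by `cancelStep`. -/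
def cancelHom (a : V) : Trace G →* Function.End (Option (Trace G) × Trace G) :=
  (traceCon G).lift (FreeMonoid.lift (cancelStep G a)) <| by
    refine Con.conGen_le.2 ?_
    rintro _ _ ⟨x, y, h, rfl, rfl⟩
    rw [Con.ker_rel, map_mul, map_mul, lift_eval_of, lift_eval_of]
    exact funext (cancelStep_comm G a h)

theorem cancelHom_letter_mul (a b : V) (q : Trace G) (p : Option (Trace G) × Trace G) :
    cancelHom G a (letter G b * q) p = cancelStep G a b (cancelHom G a q p) := by
  rw [map_mul]
  rfl

theorem cancelHom_snd (a : V) (q : Trace G) : (cancelHom G a q (none, 1)).2 = q := by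
  induction q using trace_induction with
  | one => rw [map_one]; rfl
  | letter_mul b q ih => rw [cancelHom_letter_mul, cancelStep, ih]

/-- The quotient of `q` by the letter `a` on the left, if it exists. -/
def cancel (a : V) (q : Trace G) : Option (Trace G) := (cancelHom G a q (none, 1)).1

theorem cancel_one (a : V) : cancel G a 1 = none := by
  rw [cancel, map_one]; rfl

open Classical in
theorem cancel_letter_mul (a b : V) (q : Trace G) :
    cancel G a (letter G b * q) = if a = b then some q else
      if G.Adj a b then (cancel G a q).map (letter G b * ·) else none := by
  rw [cancel, cancelHom_letter_mul, cancelStep, cancelHom_snd]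
  rfl

theorem cancel_letter_mul_self (a : V) (q : Trace G) : cancel G a (letter G a * q) = some q := by
  rw [cancel_letter_mul, if_pos rfl]

theorem letter_mul_injective (a : V) : Function.Injective (letter G a * ·) := fun q r h => by
  have := congrArg (cancel G a) h
  simpa only [cancel_letter_mul_self, Option.some.injEq] using this

theorem eq_letter_mul_of_cancel {a : V} {q r : Trace G} (h : cancel G a q = some r) :
    q = letter G a * r := by
  induction q using trace_induction generalizing r with
  | one => simp [cancel_one] at h
  | letter_mul b q ih =>
    rw [cancel_letter_mul] at h
    split_ifs at h with h1 h2
    · simp_all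
    · obtain ⟨s, hs, rfl⟩ := Option.map_eq_some_iff.1 h
      rw [ih hs, ← mul_assoc, ← letter_comm G h2, mul_assoc]

theorem exists_letter_mul {q : Trace G} (hq : q ≠ 1) : ∃ a r, q = letter G a * r := by
  induction q using trace_induction with
  | one => exact absurd rfl hq
  | letter_mul a r _ => exact ⟨a, r, rfl⟩

/-- The letter `a` divides `q` on the left. -/
def IsInitial (q : Trace G) (a : V) : Prop := (cancel G a q).isSome

theorem isInitial_letter_mul_of_ne {a b : V} (h : a ≠ b) (q : Trace G) :
    IsInitial G (letter G b * q) a ↔ G.Adj a b ∧ IsInitial G q a := by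
  rw [IsInitial, cancel_letter_mul, if_neg h]
  split_ifs with h' <;> simp [h', IsInitial]

theorem isInitial_letter_mul_self (a : V) (q : Trace G) : IsInitial G (letter G a * q) a := by
  simp [IsInitial, cancel_letter_mul_self]

theorem IsInitial.exists_eq {q : Trace G} {a : V} (h : IsInitial G q a) :
    ∃ r, q = letter G a * r := by
  obtain ⟨r, hr⟩ := Option.isSome_iff_exists.1 h
  exact ⟨r, eq_letter_mul_of_cancel G hr⟩

theorem not_isInitial_one (a : V) : ¬ IsInitial G 1 a := by
  simp [IsInitial, cancel_one]

section Counting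

variable [Fintype V]

theorem level_finite (n : ℕ) :
    {q : Trace G | ∃ w : FreeMonoid V, w.length = n ∧ (traceCon G).mk' w = q}.Finite :=
  (List.finite_length_eq V n).image (traceCon G).mk'

/-- The traces of length `n`. -/
def level (n : ℕ) : Finset (Trace G) := (level_finite G n).toFinset

theorem mem_level {n : ℕ} {q : Trace G} : q ∈ level G n ↔ len G q = Multiplicative.ofAdd n := by
  rw [level, Set.Finite.mem_toFinset, Set.mem_ofPred_eq]
  constructor
  · rintro ⟨w, rfl, rfl⟩
    exact len_mk G w
  · intro h
    obtain ⟨w, rfl⟩ := (traceCon G).mk'_surjective q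
    exact ⟨w, Multiplicative.ofAdd.injective ((len_mk G w).symm.trans h), rfl⟩

theorem mcount_eq_card (n : ℕ) : mcount G n = (level G n).card :=
  Nat.card_eq_card_finite_toFinset (level_finite G n)

theorem letter_mul_mem_level {a : V} {q : Trace G} {n : ℕ} :
    letter G a * q ∈ level G (n + 1) ↔ q ∈ level G n := by
  rw [mem_level, mem_level, map_mul, len_letter, add_comm, ofAdd_add, mul_right_inj]

theorem level_zero : level G 0 = {1} := by
  ext q
  rw [mem_level, Finset.mem_singleton]
  refine ⟨fun h => ?_, fun h => by simp [h]⟩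
  by_contra hq
  obtain ⟨a, r, rfl⟩ := exists_letter_mul G hq
  rw [map_mul, len_letter] at h
  have := congrArg Multiplicative.toAdd h
  simp at this

theorem one_notMem_level_succ (n : ℕ) : 1 ∉ level G (n + 1) := by
  rw [mem_level, map_one]
  intro h
  have := congrArg Multiplicative.toAdd h
  simp at this

theorem mcount_add_le (m n : ℕ) : mcount G (m + n) ≤ mcount G m * mcount G n := by
  classical
  rw [mcount_eq_card, mcount_eq_card, mcount_eq_card]
  refine le_trans (Finset.card_le_card ?_) (Finset.card_image₂_le (· * ·) _ _)
  intro q hq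
  obtain ⟨w, hw, rfl⟩ := (level_finite G (m + n)).mem_toFinset.1 hq
  refine Finset.mem_image₂.2 ⟨(traceCon G).mk' (ofList (w.toList.take m)), ?_,
    (traceCon G).mk' (ofList (w.toList.drop m)), ?_, ?_⟩
  · have : w.toList.length = m + n := hw
    rw [mem_level, len_mk]
    simp [FreeMonoid.length, this]
  · have : w.toList.length = m + n := hw
    rw [mem_level, len_mk]
    simp [FreeMonoid.length, this]
  · rw [← map_mul, ← ofList_append, List.take_append_drop, ofList_toList]

theorem mcount_pos [Nonempty V] (n : ℕ) : 0 < mcount G n := by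
  obtain ⟨w, hw⟩ := FreeMonoid.length_surjective (α := V) n
  rw [mcount_eq_card]
  exact Finset.card_pos.2 ⟨(traceCon G).mk' w, (mem_level G).2 (by rw [len_mk, hw])⟩

open Classical in
/-- The traces of length `n` that are divisible on the left by every letter of `C`. -/
def levelOver (C : Finset V) (n : ℕ) : Finset (Trace G) :=
  (level G n).filter fun q => ∀ a ∈ C, IsInitial G q a

theorem mem_levelOver {C : Finset V} {n : ℕ} {q : Trace G} :
    q ∈ levelOver G C n ↔ q ∈ level G n ∧ ∀ a ∈ C, IsInitial G q a := by
  simp [levelOver]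

theorem levelOver_empty (n : ℕ) : levelOver G ∅ n = level G n := by
  simp [levelOver]

open Classical in
theorem card_levelOver_insert_zero (a : V) (C : Finset V) :
    (levelOver G (insert a C) 0).card = 0 := by
  rw [Finset.card_eq_zero, Finset.eq_empty_iff_forall_notMem]
  intro q hq
  rw [mem_levelOver, level_zero, Finset.mem_singleton] at hq
  obtain ⟨rfl, h⟩ := hq
  exact not_isInitial_one G a (h a (Finset.mem_insert_self a C))

open Classical in
theorem card_levelOver_insert_succ {a : V} {C : Finset V} (ha : a ∉ C) (n : ℕ) :
    (levelOver G (insert a C) (n + 1)).card =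
      if ∀ b ∈ C, G.Adj a b then (levelOver G C n).card else 0 := by
  have key : ∀ r, letter G a * r ∈ levelOver G (insert a C) (n + 1) ↔
      (∀ b ∈ C, G.Adj a b) ∧ r ∈ levelOver G C n := by
    intro r
    have hne : ∀ b ∈ C, b ≠ a := fun b hb h => ha (h ▸ hb)
    simp only [mem_levelOver, letter_mul_mem_level, Finset.forall_mem_insert,
      isInitial_letter_mul_self, true_and]
    constructor
    · rintro ⟨h1, h2⟩
      have h3 := fun b hb => (isInitial_letter_mul_of_ne G (hne b hb) r).1 (h2 b hb)
      exact ⟨fun b hb => (h3 b hb).1.symm, h1, fun b hb => (h3 b hb).2⟩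
    · rintro ⟨h0, h1, h2⟩
      exact ⟨h1, fun b hb =>
        (isInitial_letter_mul_of_ne G (hne b hb) r).2 ⟨(h0 b hb).symm, h2 b hb⟩⟩
  have himage : ∀ q ∈ levelOver G (insert a C) (n + 1), ∃ r, q = letter G a * r := fun q hq =>
    IsInitial.exists_eq G (((mem_levelOver G).1 hq).2 a (Finset.mem_insert_self a C))
  split_ifs with h
  · rw [← Finset.card_image_of_injective (levelOver G C n) (letter_mul_injective G a)]
    congr 1
    ext q
    constructor
    · intro hq
      obtain ⟨r, rfl⟩ := himage q hq
      exact Finset.mem_image_of_mem _ ((key r).1 hq).2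
    · intro hq
      obtain ⟨r, hr, rfl⟩ := Finset.mem_image.1 hq
      exact (key r).2 ⟨h, hr⟩
  · rw [Finset.card_eq_zero, Finset.eq_empty_iff_forall_notMem]
    intro q hq
    obtain ⟨r, rfl⟩ := himage q hq
    exact h ((key r).1 hq).1

/-- The signed count of the sets of initial letters of the traces of length `n`. -/
theorem sum_neg_one_pow_mul_card_levelOver (n : ℕ) :
    ∑ C : Finset V, (-1 : ℤ) ^ C.card * ((levelOver G C n).card : ℤ) = if n = 0 then 1 else 0 := by
  classical
  have h1 : ∀ C : Finset V, (-1 : ℤ) ^ C.card * ((levelOver G C n).card : ℤ) =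
      ∑ q ∈ level G n, if ∀ a ∈ C, IsInitial G q a then (-1 : ℤ) ^ C.card else 0 := by
    intro C
    rw [← Finset.sum_filter, Finset.sum_const, nsmul_eq_mul, mul_comm]
    simp only [levelOver]
  have h2 : ∀ q : Trace G, (∑ C : Finset V,
      if ∀ a ∈ C, IsInitial G q a then (-1 : ℤ) ^ C.card else 0) = if q = 1 then 1 else 0 := by
    intro q
    have : Finset.univ.filter (fun C : Finset V => ∀ a ∈ C, IsInitial G q a) =
        (Finset.univ.filter fun a => IsInitial G q a).powerset := by
      ext C
      simp [Finset.subset_iff]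
    rw [← Finset.sum_filter, this, Finset.sum_powerset_neg_one_pow_card]
    refine if_congr ?_ rfl rfl
    rw [Finset.filter_eq_empty_iff]
    constructor
    · intro h
      by_contra hq
      obtain ⟨a, r, rfl⟩ := exists_letter_mul G hq
      exact h (Finset.mem_univ a) (isInitial_letter_mul_self G a r)
    · rintro rfl a -
      exact not_isInitial_one G a
  simp_rw [h1]
  rw [Finset.sum_comm]
  simp_rw [h2]
  rcases n with _ | n
  · simp [level_zero]
  · simp [one_notMem_level_succ]

end Counting

end TraceMonoid

namespace TraceMonoid

open Filter Topology

variable {V : Type*} [Fintype V] (G : SimpleGraph V)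

theorem subadditive_log_mcount [Nonempty V] :
    Subadditive fun n => Real.log (mcount G n : ℝ) := by
  intro m n
  have h : ∀ k, (0 : ℝ) < mcount G k := fun k => Nat.cast_pos.2 (mcount_pos G k)
  rw [← Real.log_mul (h m).ne' (h n).ne']
  exact Real.log_le_log (h _) (by exact_mod_cast mcount_add_le G m n)

theorem bddBelow_log_mcount_div :
    BddBelow (Set.range fun n : ℕ => Real.log (mcount G n : ℝ) / n) := by
  refine ⟨0, ?_⟩
  rintro _ ⟨n, rfl⟩
  exact div_nonneg (Real.log_natCast_nonneg _) n.cast_nonneg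

theorem exists_growth [Nonempty V] : ∃ L : ℝ, 0 < L ∧
    Tendsto (fun n : ℕ => (mcount G n : ℝ) ^ (1 / (n : ℝ))) atTop (𝓝 L) ∧
    ∀ n, L ^ n ≤ mcount G n := by
  have hsub := subadditive_log_mcount G
  have hbdd := bddBelow_log_mcount_div G
  have hpos : ∀ k, (0 : ℝ) < mcount G k := fun k => Nat.cast_pos.2 (mcount_pos G k)
  refine ⟨Real.exp hsub.lim, Real.exp_pos _, ?_, fun n => ?_⟩
  · refine ((Real.continuous_exp.tendsto _).comp (hsub.tendsto_lim hbdd)).congr fun n => ?_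
    rw [Function.comp_apply, Real.rpow_def_of_pos (hpos n), mul_one_div]
  · rcases Nat.eq_zero_or_pos n with rfl | hn
    · simpa using Nat.one_le_iff_ne_zero.2 (mcount_pos G 0).ne'
    · have h := hsub.lim_le_div hbdd hn.ne'
      rw [le_div_iff₀ (Nat.cast_pos.2 hn)] at h
      rw [← Real.exp_nat_mul, mul_comm, ← Real.exp_log (hpos n)]
      exact Real.exp_le_exp.2 h

theorem summable_mcount_mul_pow {L t : ℝ}
    (hL : Tendsto (fun n : ℕ => (mcount G n : ℝ) ^ (1 / (n : ℝ))) atTop (𝓝 L))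
    (hL0 : 0 < L) (ht : 0 < t) (htL : t < L⁻¹) : Summable fun n => (mcount G n : ℝ) * t ^ n := by
  obtain ⟨r, hr, hrt⟩ := exists_between ((lt_inv_comm₀ ht hL0).1 htL)
  have hr0 : 0 < r := hL0.trans hr
  refine Summable.of_norm_bounded_eventually_nat (g := fun n => (r * t) ^ n)
    (summable_geometric_of_lt_one (by positivity) ?_) ?_
  · rwa [← lt_div_iff₀ ht, one_div]
  · filter_upwards [hL.eventually_lt_const hr, eventually_ne_atTop 0] with n hn hn0
    rw [Real.norm_of_nonneg (by positivity), mul_pow]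
    gcongr
    calc (mcount G n : ℝ) = ((mcount G n : ℝ) ^ (1 / (n : ℝ))) ^ n := by
          rw [one_div, Real.rpow_inv_natCast_pow (Nat.cast_nonneg _) hn0]
      _ ≤ r ^ n := by gcongr

open Classical in
/-- The signed clique series `∑_C (-t)^|C|`, over all cliques `C`. -/
def cliqueSeries (t : ℝ) : ℝ :=
  ∑ C : Finset V, if G.IsClique (C : Set V) then (-t) ^ C.card else 0

open Classical in
theorem hasSum_card_levelOver {t H : ℝ} (hH : HasSum (fun n => (mcount G n : ℝ) * t ^ n) H)
    (C : Finset V) : HasSum (fun n => ((levelOver G C n).card : ℝ) * t ^ n)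
      (if G.IsClique (C : Set V) then t ^ C.card * H else 0) := by
  induction C using Finset.induction_on with
  | empty => simpa [levelOver_empty, mcount_eq_card] using hH
  | insert a C ha ih =>
    have hcl : G.IsClique ((insert a C : Finset V) : Set V) ↔
        G.IsClique (C : Set V) ∧ ∀ b ∈ C, G.Adj a b := by
      rw [Finset.coe_insert, SimpleGraph.isClique_insert_of_notMem (by simpa using ha)]
      simp
    rw [← hasSum_nat_add_iff' 1]
    simp only [Finset.sum_range_one, card_levelOver_insert_zero, card_levelOver_insert_succ G ha,
      hcl, Finset.card_insert_of_notMem ha, Nat.cast_zero, zero_mul, sub_zero]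
    by_cases h : ∀ b ∈ C, G.Adj a b
    · simp only [if_pos h, and_iff_left h]
      convert ih.mul_left t using 1
      · rfl
      · funext n; ring
      · split_ifs <;> ring
    · simp only [h, and_false, if_false, Nat.cast_zero, zero_mul]
      exact hasSum_zero

theorem cliqueSeries_mul_eq_one {t H : ℝ} (hH : HasSum (fun n => (mcount G n : ℝ) * t ^ n) H) :
    cliqueSeries G t * H = 1 := by
  classical
  have h1 := hasSum_sum (s := (Finset.univ : Finset (Finset V))) fun C _ =>
    (hasSum_card_levelOver G hH C).mul_left ((-1 : ℝ) ^ C.card)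
  have h2 : ∀ n : ℕ, ∑ C : Finset V, (-1 : ℝ) ^ C.card * (((levelOver G C n).card : ℝ) * t ^ n) =
      if n = 0 then 1 else 0 := by
    intro n
    have := congrArg (Int.cast : ℤ → ℝ) (sum_neg_one_pow_mul_card_levelOver G n)
    push_cast at this
    simp_rw [← mul_assoc]
    rw [← Finset.sum_mul, this]
    split_ifs with h <;> simp [h]
  simp_rw [h2] at h1
  rw [← h1.unique (hasSum_ite_eq 0 1), cliqueSeries, Finset.sum_mul]
  refine Finset.sum_congr rfl fun C _ => ?_
  split_ifs
  · rw [neg_pow]; ring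
  · simp

theorem card_le_cliqueNum {C : Finset V} (hC : G.IsClique (C : Set V)) :
    C.card ≤ cliqueNum G :=
  le_csSup ⟨Fintype.card V, by rintro _ ⟨s, hs⟩; exact hs.card_eq ▸ s.card_le_univ⟩ ⟨C, hC, rfl⟩

theorem eval_PCpoly {x : ℝ} (hx : x ≠ 0) :
    (PCpoly G).eval x = x ^ cliqueNum G * cliqueSeries G x⁻¹ := by
  classical
  have h : cliqueSeries G x⁻¹ =
      ∑ k ∈ Finset.range (cliqueNum G + 1), (cliqueCount G k : ℝ) * (-x⁻¹) ^ k := by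
    rw [cliqueSeries, ← Finset.sum_filter, ← Finset.sum_fiberwise_of_maps_to
      (g := Finset.card) (t := Finset.range (cliqueNum G + 1))]
    · refine Finset.sum_congr rfl fun k _ => ?_
      rw [Finset.sum_congr rfl (g := fun _ => (-x⁻¹) ^ k) fun C hC => by
        rw [(Finset.mem_filter.1 hC).2], Finset.sum_const, nsmul_eq_mul, Finset.filter_filter,
        cliqueCount, Nat.card_eq_fintype_card, Fintype.card_subtype]
      simp only [SimpleGraph.isNClique_iff]
    · intro C hC
      exact Finset.mem_range_succ_iff.2 (card_le_cliqueNum G (Finset.mem_filter.1 hC).2)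
  rw [h, PCpoly, Polynomial.eval_finsetSum, Finset.mul_sum]
  refine Finset.sum_congr rfl fun k hk => ?_
  rw [Polynomial.eval_mul, Polynomial.eval_C, Polynomial.eval_pow, Polynomial.eval_X,
    pow_sub₀ x hx (Finset.mem_range_succ_iff.1 hk), neg_pow x⁻¹, inv_pow]
  ring

theorem continuous_cliqueSeries : Continuous (cliqueSeries G) := by
  classical
  unfold cliqueSeries
  refine continuous_finsetSum _ fun C _ => ?_
  split_ifs <;> fun_prop

theorem cliqueSeries_mem_Icc {L t : ℝ}
    (hL : Tendsto (fun n : ℕ => (mcount G n : ℝ) ^ (1 / (n : ℝ))) atTop (𝓝 L))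
    (hL0 : 0 < L) (hLn : ∀ n, L ^ n ≤ mcount G n) (ht : 0 < t) (htL : t < L⁻¹) :
    0 < cliqueSeries G t ∧ cliqueSeries G t ≤ 1 - L * t := by
  obtain ⟨H, hH⟩ := summable_mcount_mul_pow G hL hL0 ht htL
  have h1 := cliqueSeries_mul_eq_one G hH
  have hLt : L * t < 1 := by rwa [← lt_div_iff₀' hL0, one_div]
  have hgeom := hasSum_geometric_of_lt_one (by positivity : 0 ≤ L * t) hLt
  have hle : (1 - L * t)⁻¹ ≤ H := hasSum_le (fun n => by
    rw [mul_pow]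
    exact mul_le_mul_of_nonneg_right (hLn n) (by positivity)) hgeom hH
  have hHpos : 0 < H := (inv_pos.2 (sub_pos.2 hLt)).trans_le hle
  rw [eq_inv_of_mul_eq_one_left h1]
  exact ⟨inv_pos.2 hHpos, inv_le_of_inv_le₀ (sub_pos.2 hLt) hle⟩

theorem cliqueSeries_inv_growth {L : ℝ}
    (hL : Tendsto (fun n : ℕ => (mcount G n : ℝ) ^ (1 / (n : ℝ))) atTop (𝓝 L))
    (hL0 : 0 < L) (hLn : ∀ n, L ^ n ≤ mcount G n) : cliqueSeries G L⁻¹ = 0 := by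
  have hev : ∀ᶠ t in 𝓝[<] L⁻¹, 0 < t ∧ t < L⁻¹ :=
    Ioo_mem_nhdsLT (inv_pos.2 hL0)
  have hlim : Tendsto (fun t => 1 - L * t) (𝓝[<] L⁻¹) (𝓝 0) := by
    have : Continuous fun t => 1 - L * t := by fun_prop
    simpa [hL0.ne'] using (this.tendsto L⁻¹).mono_left nhdsWithin_le_nhds
  refine tendsto_nhds_unique
    (((continuous_cliqueSeries G).tendsto L⁻¹).mono_left nhdsWithin_le_nhds)
    (tendsto_of_tendsto_of_tendsto_of_le_of_le' tendsto_const_nhds hlim ?_ ?_)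
  · filter_upwards [hev] with t ht
    exact (cliqueSeries_mem_Icc G hL hL0 hLn ht.1 ht.2).1.le
  · filter_upwards [hev] with t ht
    exact (cliqueSeries_mem_Icc G hL hL0 hLn ht.1 ht.2).2

theorem isGreatest_growth {L : ℝ}
    (hL : Tendsto (fun n : ℕ => (mcount G n : ℝ) ^ (1 / (n : ℝ))) atTop (𝓝 L))
    (hL0 : 0 < L) (hLn : ∀ n, L ^ n ≤ mcount G n) :
    IsGreatest {x : ℝ | (PCpoly G).eval x = 0} L := by
  constructor
  · rw [Set.mem_ofPred_eq, eval_PCpoly G hL0.ne', cliqueSeries_inv_growth G hL hL0 hLn, mul_zero]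
  · intro x hx
    by_contra! hlt
    have hx0 : 0 < x := hL0.trans hlt
    rw [Set.mem_ofPred_eq, eval_PCpoly G hx0.ne'] at hx
    have := (cliqueSeries_mem_Icc G hL hL0 hLn (inv_pos.2 hx0)
      ((inv_lt_inv₀ hx0 hL0).2 hlt)).1
    exact (mul_pos (pow_pos hx0 _) this).ne' hx

end TraceMonoid

/-- The growth rate of the partially commutative monoid `M(X,G)` exists and
equals `β(G)`: `(m_n)^{1/n} → β(G)` as `n → ∞`. -/
theorem stmt_2 {V : Type*} [Fintype V] [Nonempty V] (G : SimpleGraph V) :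
    Filter.Tendsto (fun n : ℕ => (mcount G n : ℝ) ^ (1 / (n : ℝ)))
      Filter.atTop (nhds (beta G)) := by
  obtain ⟨L, hL0, hL, hLn⟩ := TraceMonoid.exists_growth G
  rwa [beta, (TraceMonoid.isGreatest_growth G hL hL0 hLn).csSup_eq]
end
end

section
/- Let G be a finite simple graph with n ≥ 1 vertices. Then n/ω(G) ≤ β(G) ≤ n. The lower bound is attained if and only if ω(G) divides n and G is the complete multipartite graph with ω(G) parts each of size n/ω(G); the upper bound is attained if and only if G has no edges. Moreover, if G is not a complete graph and n > 1, then β(G) ≥ 2. -/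
noncomputable section

section CliqueSums

open scoped Classical

variable {V : Type*} (G : SimpleGraph V)

/-- The cliques of `G` contained in `U`. -/
def cliquesIn (U : Finset V) : Finset (Finset V) :=
  U.powerset.filter fun S => G.IsClique (S : Set V)

/-- The neighbours of `v` in `U`. -/
def nbrsIn (U : Finset V) (v : V) : Finset V :=
  U.filter fun w => G.Adj v w

/-- The vertices of `U` adjacent to every vertex of `S`. -/
def commonNbrsIn (U S : Finset V) : Finset V :=
  U.filter fun w => ∀ s ∈ S, G.Adj s w

/-- The alternating clique generating function of the subgraph of `G` induced on `U`. -/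
def altCliqueSum (U : Finset V) (t : ℝ) : ℝ :=
  ∑ S ∈ cliquesIn G U, (-t) ^ S.card

variable {G}

lemma mem_cliquesIn {U S : Finset V} : S ∈ cliquesIn G U ↔ S ⊆ U ∧ G.IsClique (S : Set V) := by
  simp [cliquesIn]

lemma mem_nbrsIn {U : Finset V} {v w : V} : w ∈ nbrsIn G U v ↔ w ∈ U ∧ G.Adj v w := by
  simp [nbrsIn]

lemma mem_commonNbrsIn {U S : Finset V} {w : V} :
    w ∈ commonNbrsIn G U S ↔ w ∈ U ∧ ∀ s ∈ S, G.Adj s w := by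
  simp [commonNbrsIn]

lemma nbrsIn_subset_erase (U : Finset V) (v : V) : nbrsIn G U v ⊆ U.erase v := by
  intro w hw
  rw [mem_nbrsIn] at hw
  exact Finset.mem_erase.2 ⟨hw.2.ne', hw.1⟩

lemma notMem_nbrsIn (U : Finset V) (v : V) : v ∉ nbrsIn G U v := by
  simp [mem_nbrsIn]

lemma cliquesIn_nbrsIn (U : Finset V) (v : V) :
    cliquesIn G (nbrsIn G U v) =
      (cliquesIn G (U.erase v)).filter fun S => ∀ s ∈ S, G.Adj s v := by
  ext S
  simp only [mem_cliquesIn, Finset.mem_filter]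
  constructor
  · rintro ⟨h, hS⟩
    exact ⟨⟨h.trans (nbrsIn_subset_erase U v), hS⟩, fun s hs => (mem_nbrsIn.1 (h hs)).2.symm⟩
  · rintro ⟨⟨h, hS⟩, hv⟩
    exact ⟨fun s hs => mem_nbrsIn.2 ⟨Finset.mem_of_mem_erase (h hs), (hv s hs).symm⟩, hS⟩

lemma sum_cliquesIn_eq_add {U : Finset V} {v : V} (hv : v ∈ U) (f : Finset V → ℝ) :
    ∑ S ∈ cliquesIn G U, f S =
      ∑ S ∈ cliquesIn G (U.erase v), f S + ∑ S ∈ cliquesIn G (nbrsIn G U v), f (insert v S) := by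
  rw [← Finset.sum_filter_add_sum_filter_not (cliquesIn G U) (fun S => v ∈ S), add_comm]
  congr 1
  · refine Finset.sum_congr ?_ fun _ _ => rfl
    ext S
    simp only [Finset.mem_filter, mem_cliquesIn, Finset.subset_erase]
    tauto
  · symm
    refine Finset.sum_bij (fun S _ => insert v S) ?_ ?_ ?_ fun _ _ => rfl
    · intro S hS
      rw [mem_cliquesIn] at hS
      simp only [Finset.mem_filter, mem_cliquesIn, Finset.mem_insert_self, and_true,
        Finset.coe_insert, SimpleGraph.isClique_insert, Finset.insert_subset_iff]
      exact ⟨⟨hv, fun s hs => (mem_nbrsIn.1 (hS.1 hs)).1⟩, hS.2,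
        fun s hs _ => (mem_nbrsIn.1 (hS.1 hs)).2⟩
    · intro S hS T hT h
      have hS' : v ∉ S := fun h => notMem_nbrsIn U v ((mem_cliquesIn.1 hS).1 h)
      have hT' : v ∉ T := fun h => notMem_nbrsIn U v ((mem_cliquesIn.1 hT).1 h)
      rw [← Finset.erase_insert hS', ← Finset.erase_insert hT', h]
    · intro S hS
      simp only [Finset.mem_filter, mem_cliquesIn] at hS
      obtain ⟨⟨hSU, hS⟩, hvS⟩ := hS
      refine ⟨S.erase v, mem_cliquesIn.2 ⟨fun s hs => ?_, ?_⟩, Finset.insert_erase hvS⟩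
      · rw [Finset.mem_erase] at hs
        exact mem_nbrsIn.2 ⟨hSU hs.2, hS hvS hs.2 hs.1.symm⟩
      · exact hS.subset (Finset.coe_subset.2 (Finset.erase_subset v S))

lemma altCliqueSum_eq_sub {U : Finset V} {v : V} (hv : v ∈ U) (t : ℝ) :
    altCliqueSum G U t = altCliqueSum G (U.erase v) t - t * altCliqueSum G (nbrsIn G U v) t := by
  unfold altCliqueSum
  rw [sum_cliquesIn_eq_add hv, sub_eq_add_neg, ← neg_mul, Finset.mul_sum]
  congr 1
  refine Finset.sum_congr rfl fun S hS => ?_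
  rw [Finset.card_insert_of_notMem fun h => notMem_nbrsIn U v ((mem_cliquesIn.1 hS).1 h), pow_succ']

lemma cliquesIn_empty : cliquesIn G ∅ = {∅} := by
  ext S
  simp +contextual [mem_cliquesIn, Finset.subset_empty]

@[simp]
lemma altCliqueSum_empty (t : ℝ) : altCliqueSum G ∅ t = 1 := by
  simp [altCliqueSum, cliquesIn_empty]

lemma altCliqueSum_at_zero (U : Finset V) : altCliqueSum G U 0 = 1 := by
  induction U using Finset.strongInduction with
  | H U ih =>
    obtain rfl | ⟨v, hv⟩ := U.eq_empty_or_nonempty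
    · simp
    · rw [altCliqueSum_eq_sub hv, ih _ (Finset.erase_ssubset hv)]
      simp

lemma continuous_altCliqueSum (U : Finset V) : Continuous (altCliqueSum G U) := by
  unfold altCliqueSum
  fun_prop

lemma commonNbrsIn_of_notMem {U S : Finset V} {v : V} (h : v ∉ commonNbrsIn G U S) :
    commonNbrsIn G (U.erase v) S = commonNbrsIn G U S := by
  ext w
  by_cases hw : w = v
  · subst hw
    simp [mem_commonNbrsIn] at h ⊢
    exact h
  · simp [mem_commonNbrsIn, hw]

lemma erase_commonNbrsIn (U S : Finset V) (v : V) :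
    (commonNbrsIn G U S).erase v = commonNbrsIn G (U.erase v) S := by
  ext w
  simp [mem_commonNbrsIn, and_assoc]

lemma nbrsIn_commonNbrsIn (U S : Finset V) (v : V) :
    nbrsIn G (commonNbrsIn G U S) v = commonNbrsIn G (nbrsIn G U v) S := by
  ext w
  simp only [mem_commonNbrsIn, mem_nbrsIn]
  tauto

lemma commonNbrsIn_insert (U S : Finset V) (v : V) :
    commonNbrsIn G U (insert v S) = commonNbrsIn G (nbrsIn G U v) S := by
  ext w
  simp only [mem_commonNbrsIn, mem_nbrsIn, Finset.mem_insert, forall_eq_or_imp]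
  tauto

/-- The expectation of `c |S|` over random cliques `S` in `U`, where `S` has (possibly negative)
probability `t ^ |S|` times the alternating clique sum of its common neighbourhood. -/
def cliqueExpect (G : SimpleGraph V) (t : ℝ) (c : ℕ → ℝ) (U : Finset V) : ℝ :=
  ∑ S ∈ cliquesIn G U, c S.card * (t ^ S.card * altCliqueSum G (commonNbrsIn G U S) t)

lemma cliqueExpect_eq_add (t : ℝ) (c : ℕ → ℝ) {U : Finset V} {v : V} (hv : v ∈ U) :
    cliqueExpect G t c U = cliqueExpect G t c (U.erase v) +
      t * cliqueExpect G t (fun k => c (k + 1) - c k) (nbrsIn G U v) := by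
  have key : ∀ S ∈ cliquesIn G (U.erase v),
      c S.card * (t ^ S.card * altCliqueSum G (commonNbrsIn G U S) t) =
      c S.card * (t ^ S.card * altCliqueSum G (commonNbrsIn G (U.erase v) S) t) -
      if ∀ s ∈ S, G.Adj s v then
        t * (c S.card * (t ^ S.card * altCliqueSum G (commonNbrsIn G (nbrsIn G U v) S) t))
      else 0 := by
    intro S _
    split_ifs with h
    · rw [altCliqueSum_eq_sub (mem_commonNbrsIn.2 ⟨hv, h⟩), erase_commonNbrsIn,
        nbrsIn_commonNbrsIn]
      ring
    · rw [commonNbrsIn_of_notMem fun h' => h (mem_commonNbrsIn.1 h').2, sub_zero]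
  unfold cliqueExpect
  rw [sum_cliquesIn_eq_add hv, Finset.sum_congr rfl key, Finset.sum_sub_distrib,
    ← Finset.sum_filter, ← cliquesIn_nbrsIn, sub_add,
    ← sub_neg_eq_add _ (t * _), ← Finset.sum_sub_distrib, Finset.mul_sum, ← Finset.sum_neg_distrib]
  congr 1
  refine Finset.sum_congr rfl fun S hS => ?_
  rw [Finset.card_insert_of_notMem fun h => notMem_nbrsIn U v ((mem_cliquesIn.1 hS).1 h), pow_succ',
    commonNbrsIn_insert]
  ring

lemma commonNbrsIn_empty (U : Finset V) : commonNbrsIn G U ∅ = U := by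
  simp [commonNbrsIn]

lemma cliqueExpect_empty (t : ℝ) (c : ℕ → ℝ) : cliqueExpect G t c ∅ = c 0 := by
  simp [cliqueExpect, cliquesIn_empty, commonNbrsIn_empty]

lemma cliqueExpect_zero (t : ℝ) (U : Finset V) : cliqueExpect G t (fun _ => 0) U = 0 := by
  simp [cliqueExpect]

lemma cliqueExpect_one (t : ℝ) (U : Finset V) : cliqueExpect G t (fun _ => 1) U = 1 := by
  induction U using Finset.strongInduction with
  | H U ih =>
    obtain rfl | ⟨v, hv⟩ := U.eq_empty_or_nonempty
    · rw [cliqueExpect_empty]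
    · rw [cliqueExpect_eq_add _ _ hv, ih _ (Finset.erase_ssubset hv)]
      simp [cliqueExpect_zero]

lemma cliqueExpect_card (t : ℝ) (U : Finset V) :
    cliqueExpect G t (fun k => k) U = U.card * t := by
  induction U using Finset.strongInduction with
  | H U ih =>
    obtain rfl | ⟨v, hv⟩ := U.eq_empty_or_nonempty
    · simp [cliqueExpect_empty]
    · rw [cliqueExpect_eq_add _ _ hv, ih _ (Finset.erase_ssubset hv)]
      have : ((U.erase v).card : ℝ) + 1 = U.card := by
        exact_mod_cast Finset.card_erase_add_one hv
      simp only [Nat.cast_add, Nat.cast_one, add_sub_cancel_left, cliqueExpect_one, ← this]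
      ring

lemma sum_deficit_eq (r : ℝ) (m : ℝ) (U : Finset V) :
    ∑ S ∈ cliquesIn G U, (m - S.card) * (r ^ S.card * altCliqueSum G (commonNbrsIn G U S) r) =
      m - U.card * r := by
  have h1 := cliqueExpect_one (G := G) r U
  have hcard := cliqueExpect_card (G := G) r U
  simp only [cliqueExpect, one_mul] at h1 hcard
  simp only [sub_mul, Finset.sum_sub_distrib, ← Finset.mul_sum, h1, hcard, mul_one]

lemma exists_first_zero {f : ℝ → ℝ} (hf : Continuous f) (h0 : 0 < f 0) {a : ℝ} (ha : 0 ≤ a)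
    (hfa : f a ≤ 0) :
    ∃ s, 0 < s ∧ s ≤ a ∧ f s = 0 ∧ ∀ r, 0 ≤ r → r < s → 0 < f r := by
  have hne : (Set.Icc 0 a ∩ f ⁻¹' {0}).Nonempty := by
    obtain ⟨x, hx, hfx⟩ := intermediate_value_Icc' ha hf.continuousOn ⟨hfa, h0.le⟩
    exact ⟨x, hx, hfx⟩
  obtain ⟨s, ⟨hs, hfs⟩, hmin⟩ :=
    (isCompact_Icc.inter_right (isClosed_singleton.preimage hf)).exists_isLeast hne
  refine ⟨s, hs.1.lt_of_ne ?_, hs.2, hfs, fun r hr hrs => ?_⟩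
  · rintro rfl
    exact h0.ne' hfs
  · by_contra! hfr
    obtain ⟨x, hx, hfx⟩ := intermediate_value_Icc' hr hf.continuousOn ⟨hfr, h0.le⟩
    exact absurd (hmin ⟨⟨hx.1, hx.2.trans (hrs.le.trans hs.2)⟩, hfx⟩) (hx.2.trans_lt hrs).not_ge

lemma nonneg_of_pos_of_lt {f : ℝ → ℝ} (hf : Continuous f) {t : ℝ} (ht : 0 < t)
    (h : ∀ s, 0 ≤ s → s < t → 0 < f s) : 0 ≤ f t := by
  by_contra! hlt
  obtain ⟨s, hs, hst, hs0, -⟩ := exists_first_zero hf (h 0 le_rfl ht) ht.le hlt.le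
  refine (h s hs.le (hst.lt_of_ne ?_)).ne' hs0
  rintro rfl
  exact hlt.ne hs0

lemma altCliqueSum_pos_of_subset (U : Finset V) :
    ∀ t : ℝ, (∀ s, 0 ≤ s → s < t → 0 < altCliqueSum G U s) →
      ∀ W ⊆ U, ∀ s, 0 ≤ s → s < t → 0 < altCliqueSum G W s := by
  induction U using Finset.strongInduction with
  | H U ih =>
    intro t ht W hW
    obtain rfl | hWU := eq_or_ne W U
    · exact ht
    obtain ⟨v, hvU, hvW⟩ := Finset.exists_of_ssubset (hW.ssubset_of_ne hWU)
    refine ih _ (Finset.erase_ssubset hvU) t (fun a ha hat => ?_) W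
      (Finset.subset_erase.2 ⟨hW, hvW⟩)
    by_contra! hle
    obtain ⟨s, hs, hsa, hs0, hpos⟩ := exists_first_zero (continuous_altCliqueSum _)
      (by simp [altCliqueSum_at_zero]) ha hle
    have hN : 0 ≤ altCliqueSum G (nbrsIn G U v) s :=
      nonneg_of_pos_of_lt (continuous_altCliqueSum _) hs
        (ih _ (Finset.erase_ssubset hvU) s hpos _ (nbrsIn_subset_erase U v))
    have := ht s hs.le (hsa.trans_lt hat)
    rw [altCliqueSum_eq_sub hvU, hs0] at this
    nlinarith

lemma nbrsIn_eq_empty {U : Finset V} {v : V} (h : ∀ w ∈ U, ¬ G.Adj v w) : nbrsIn G U v = ∅ :=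
  Finset.filter_false_of_mem h

lemma altCliqueSum_of_independent (t : ℝ) {U : Finset V} (h : ∀ u ∈ U, ∀ v ∈ U, ¬ G.Adj u v) :
    altCliqueSum G U t = 1 - U.card * t := by
  induction U using Finset.induction_on with
  | empty => simp
  | insert v U hv ih =>
    rw [altCliqueSum_eq_sub (Finset.mem_insert_self v U), Finset.erase_insert hv,
      nbrsIn_eq_empty (h v (Finset.mem_insert_self v U)), Finset.card_insert_of_notMem hv,
      ih fun u hu w hw => h u (Finset.mem_insert_of_mem hu) w (Finset.mem_insert_of_mem hw)]
    simp
    ring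

lemma altCliqueSum_bounds {t : ℝ} (ht : 0 ≤ t) (U : Finset V) (hU : U.card * t ≤ 1) :
    1 - U.card * t ≤ altCliqueSum G U t ∧ altCliqueSum G U t ≤ 1 := by
  induction U using Finset.strongInduction with
  | H U ih =>
    obtain rfl | ⟨v, hv⟩ := U.eq_empty_or_nonempty
    · simp
    have hsub : ∀ W ⊆ U, (W.card : ℝ) * t ≤ U.card * t := fun W hW => by
      have := Finset.card_le_card hW
      gcongr
    have hN := ((nbrsIn_subset_erase (G := G) U v).trans_ssubset (Finset.erase_ssubset hv))
    obtain ⟨h1, h2⟩ := ih _ (Finset.erase_ssubset hv) ((hsub _ (Finset.erase_subset v U)).trans hU)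
    obtain ⟨h3, h4⟩ := ih _ hN ((hsub _ hN.subset).trans hU)
    have hcard : ((U.erase v).card : ℝ) + 1 = U.card := by
      exact_mod_cast Finset.card_erase_add_one hv
    have := hsub _ hN.subset
    rw [altCliqueSum_eq_sub hv, ← hcard]
    constructor <;> nlinarith

lemma one_sub_lt_altCliqueSum {t : ℝ} (ht : 0 < t) {U : Finset V} (hU : U.card * t ≤ 1)
    {u v : V} (hu : u ∈ U) (hv : v ∈ U) (huv : G.Adj u v) :
    1 - U.card * t < altCliqueSum G U t := by
  have hsub : ∀ W ⊆ U, (W.card : ℝ) * t ≤ U.card * t := fun W hW => by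
    have := Finset.card_le_card hW
    gcongr
  have hcard : ∀ {W : Finset V} {v : V}, v ∈ W → ((W.erase v).card : ℝ) + 1 = W.card :=
    fun hv => by exact_mod_cast Finset.card_erase_add_one hv
  have hvN : v ∈ nbrsIn G U u := mem_nbrsIn.2 ⟨hv, huv⟩
  set N := nbrsIn G U u with hN
  have hNU : N ⊆ U.erase u := nbrsIn_subset_erase U u
  have hMN : nbrsIn G N v ⊆ N.erase v := nbrsIn_subset_erase N v
  have hNU' := hNU.trans (Finset.erase_subset u U)
  have hN1 := (altCliqueSum_bounds (G := G) ht.le (N.erase v)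
    ((hsub _ ((Finset.erase_subset v N).trans hNU')).trans hU)).2
  have hM := (altCliqueSum_bounds (G := G) ht.le (nbrsIn G N v)
    ((hsub _ (hMN.trans ((Finset.erase_subset v N).trans hNU'))).trans hU)).1
  have hE := (altCliqueSum_bounds (G := G) ht.le (U.erase u)
    ((hsub _ (Finset.erase_subset u U)).trans hU)).1
  have hMU : ((nbrsIn G N v).card : ℝ) + 1 ≤ U.card := by
    have := Finset.card_le_card (hMN.trans ((Finset.erase_subset v N).trans hNU))
    rw [← hcard hu]
    gcongr
  have hMpos : 0 < altCliqueSum G (nbrsIn G N v) t := by nlinarith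
  rw [altCliqueSum_eq_sub hu, ← hN, altCliqueSum_eq_sub hvN, ← hcard hu]
  nlinarith [mul_pos ht (mul_pos ht hMpos)]

lemma altCliqueSum_multipartite {k : ℕ} {f : V → Fin k} (hf : ∀ u v, G.Adj u v ↔ f u ≠ f v)
    (t : ℝ) (U : Finset V) :
    altCliqueSum G U t = ∏ i, (1 - (U.filter fun v => f v = i).card * t) := by
  induction U using Finset.strongInduction with
  | H U ih =>
    obtain rfl | ⟨v, hv⟩ := U.eq_empty_or_nonempty
    · simp
    have hN := ((nbrsIn_subset_erase (G := G) U v).trans_ssubset (Finset.erase_ssubset hv))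
    have hi : f v ∈ Finset.univ := Finset.mem_univ _
    have hmem : v ∈ U.filter fun w => f w = f v := by simp [hv]
    have hE : (U.erase v).filter (fun w => f w = f v) = (U.filter fun w => f w = f v).erase v :=
      Finset.filter_erase _ _ _
    have hN0 : (nbrsIn G U v).filter (fun w => f w = f v) = ∅ := by
      ext w
      simp +contextual [mem_nbrsIn, hf, eq_comm]
    have hprod : ∀ W ⊆ U, (∀ w ∈ U, f w ≠ f v → w ∈ W) →
        ∏ i ∈ Finset.univ.erase (f v), (1 - ((W.filter fun w => f w = i).card : ℝ) * t) =
        ∏ i ∈ Finset.univ.erase (f v), (1 - ((U.filter fun w => f w = i).card : ℝ) * t) := by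
      intro W hW h
      refine Finset.prod_congr rfl fun i hi => ?_
      have : (W.filter fun w => f w = i) = U.filter fun w => f w = i := by
        ext w
        simp only [Finset.mem_filter]
        refine ⟨fun h => ⟨hW h.1, h.2⟩, fun h' => ⟨h w h'.1 ?_, h'.2⟩⟩
        rw [h'.2]
        exact Finset.ne_of_mem_erase hi
      rw [this]
    rw [altCliqueSum_eq_sub hv, ih _ (Finset.erase_ssubset hv), ih _ hN,
      ← Finset.mul_prod_erase _ _ hi, ← Finset.mul_prod_erase _ _ hi,
      ← Finset.mul_prod_erase _ _ hi,
      hprod _ (Finset.erase_subset v U) fun w hw hwv => 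
        Finset.mem_erase.2 ⟨fun h => hwv (congrArg f h), hw⟩,
      hprod _ hN.subset fun w hw hwv => mem_nbrsIn.2 ⟨hw, (hf v w).2 hwv.symm⟩, hE, hN0,
      ← Finset.card_erase_add_one hmem]
    push_cast
    simp
    ring

variable [Fintype V]

/-- `r` is the least positive zero of the alternating clique sum of `G`. -/
structure IsLeastPosZero (G : SimpleGraph V) (r : ℝ) : Prop where
  pos : 0 < r
  eq_zero : altCliqueSum G Finset.univ r = 0
  pos_of_lt : ∀ s, 0 ≤ s → s < r → 0 < altCliqueSum G Finset.univ s

lemma exists_isLeastPosZero [Nonempty V] (G : SimpleGraph V) : ∃ r, IsLeastPosZero G r := by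
  by_contra! h
  have hpos : ∀ s, 0 ≤ s → 0 < altCliqueSum G Finset.univ s := by
    intro s hs
    by_contra! hle
    obtain ⟨r, hr, -, hr0, hlt⟩ := exists_first_zero (continuous_altCliqueSum _)
      (by simp [altCliqueSum_at_zero]) hs hle
    exact h r ⟨hr, hr0, hlt⟩
  obtain ⟨v⟩ := ‹Nonempty V›
  have := altCliqueSum_pos_of_subset Finset.univ 2 (fun s hs _ => hpos s hs) {v}
    (Finset.subset_univ _) 1 (by norm_num) (by norm_num)
  rw [altCliqueSum_of_independent _ (by simp)] at this
  simp at this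

lemma IsLeastPosZero.altCliqueSum_nonneg {r : ℝ} (h : IsLeastPosZero G r) (U : Finset V) :
    0 ≤ altCliqueSum G U r :=
  nonneg_of_pos_of_lt (continuous_altCliqueSum _) h.pos
    (altCliqueSum_pos_of_subset _ r h.pos_of_lt U (Finset.subset_univ U))

lemma card_le_cliqueNum {S : Finset V} (hS : G.IsClique (S : Set V)) : S.card ≤ cliqueNum G :=
  hS.card_le_cliqueNum

lemma exists_clique_card_eq (G : SimpleGraph V) :
    ∃ S : Finset V, G.IsClique (S : Set V) ∧ S.card = cliqueNum G := by
  obtain ⟨S, hS⟩ := G.exists_isNClique_cliqueNum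
  exact ⟨S, hS.1, hS.2⟩

lemma cliqueNum_pos [Nonempty V] (G : SimpleGraph V) : 0 < cliqueNum G := by
  obtain ⟨v⟩ := ‹Nonempty V›
  have := card_le_cliqueNum (G := G) (S := {v}) (by simp)
  rwa [Finset.card_singleton] at this

lemma altCliqueSum_univ_eq (G : SimpleGraph V) (t : ℝ) :
    altCliqueSum G Finset.univ t =
      ∑ k ∈ Finset.range (cliqueNum G + 1), (-1) ^ k * (cliqueCount G k : ℝ) * t ^ k := by
  unfold altCliqueSum
  rw [← Finset.sum_fiberwise_of_maps_to (g := Finset.card)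
    (t := Finset.range (cliqueNum G + 1))]
  · refine Finset.sum_congr rfl fun k _ => ?_
    have hcount : cliqueCount G k =
        ((cliquesIn G Finset.univ).filter fun S => S.card = k).card := by
      unfold cliqueCount
      rw [Nat.card_eq_fintype_card, Fintype.card_subtype]
      congr 1
      ext S
      simp [mem_cliquesIn, SimpleGraph.isNClique_iff]
    rw [Finset.sum_congr rfl fun S hS => by rw [(Finset.mem_filter.1 hS).2], Finset.sum_const,
      hcount, nsmul_eq_mul, neg_pow]
    ring
  · intro S hS
    exact Finset.mem_range_succ_iff.2 (card_le_cliqueNum (mem_cliquesIn.1 hS).2)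

lemma eval_PCpoly (G : SimpleGraph V) {x : ℝ} (hx : x ≠ 0) :
    (PCpoly G).eval x = x ^ cliqueNum G * altCliqueSum G Finset.univ (1 / x) := by
  rw [altCliqueSum_univ_eq, PCpoly, Polynomial.eval_finsetSum, Finset.mul_sum]
  refine Finset.sum_congr rfl fun k hk => ?_
  rw [← Nat.sub_add_cancel (Finset.mem_range_succ_iff.1 hk), Nat.add_sub_cancel, pow_add]
  simp only [Polynomial.eval_mul, Polynomial.eval_C, Polynomial.eval_pow, Polynomial.eval_X]
  rw [one_div, inv_pow]
  field_simp

lemma IsLeastPosZero.beta_eq {r : ℝ} (h : IsLeastPosZero G r) : beta G = 1 / r := by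
  refine IsGreatest.csSup_eq ⟨?_, fun x hx => ?_⟩
  · change (PCpoly G).eval (1 / r) = 0
    rw [eval_PCpoly G (one_div_pos.2 h.pos).ne', one_div_one_div, h.eq_zero,
      mul_zero]
  · obtain hx0 | hx0 := le_or_gt x 0
    · exact hx0.trans (one_div_pos.2 h.pos).le
    · replace hx : (PCpoly G).eval x = 0 := hx
      rw [eval_PCpoly G hx0.ne', mul_eq_zero_iff_left (pow_pos hx0 _).ne'] at hx
      by_contra! hlt
      exact (h.pos_of_lt _ (one_div_pos.2 hx0).le ((one_div_lt h.pos hx0).1 hlt)).ne' hx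

lemma IsLeastPosZero.deficit_nonneg {r : ℝ} (h : IsLeastPosZero G r) {S : Finset V}
    (hS : S ∈ cliquesIn G Finset.univ) :
    0 ≤ ((cliqueNum G : ℝ) - S.card) *
      (r ^ S.card * altCliqueSum G (commonNbrsIn G Finset.univ S) r) := by
  have h1 : (S.card : ℝ) ≤ cliqueNum G := by exact_mod_cast card_le_cliqueNum (mem_cliquesIn.1 hS).2
  exact mul_nonneg (sub_nonneg.2 h1) (mul_nonneg (pow_pos h.pos _).le (h.altCliqueSum_nonneg _))

lemma IsLeastPosZero.card_mul_le {r : ℝ} (h : IsLeastPosZero G r) :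
    Fintype.card V * r ≤ cliqueNum G := by
  have := Finset.sum_nonneg fun S hS => h.deficit_nonneg (S := S) hS
  rwa [sum_deficit_eq, sub_nonneg, Finset.card_univ] at this

lemma IsLeastPosZero.altCliqueSum_commonNbrs_eq_zero {r : ℝ} (h : IsLeastPosZero G r)
    (heq : Fintype.card V * r = cliqueNum G) {S : Finset V} (hS : G.IsClique (S : Set V))
    (hlt : S.card < cliqueNum G) : altCliqueSum G (commonNbrsIn G Finset.univ S) r = 0 := by
  have hsum := sum_deficit_eq (G := G) r (cliqueNum G) Finset.univ
  rw [Finset.card_univ, heq, sub_self,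
    Finset.sum_eq_zero_iff_of_nonneg fun S hS => h.deficit_nonneg hS] at hsum
  have := hsum S (mem_cliquesIn.2 ⟨Finset.subset_univ S, hS⟩)
  have h1 : (S.card : ℝ) < cliqueNum G := by exact_mod_cast hlt
  rwa [mul_eq_zero_iff_left (sub_pos.2 h1).ne', mul_eq_zero_iff_left (pow_pos h.pos _).ne'] at this

lemma commonNbrsIn_independent {S : Finset V} (hS : G.IsClique (S : Set V))
    (hcard : S.card + 1 = cliqueNum G) :
    ∀ u ∈ commonNbrsIn G Finset.univ S, ∀ v ∈ commonNbrsIn G Finset.univ S, ¬ G.Adj u v := by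
  intro u hu v hv huv
  rw [mem_commonNbrsIn] at hu hv
  have huS : u ∉ S := fun h => G.loopless.irrefl u (hu.2 u h)
  have hvS : v ∉ S := fun h => G.loopless.irrefl v (hv.2 v h)
  have hvuS : v ∉ insert u S := by simp [hvS, huv.ne']
  have hclique : G.IsClique (insert v (insert u S) : Finset V) := by
    simp only [Finset.coe_insert, SimpleGraph.isClique_insert]
    refine ⟨⟨hS, fun s hs _ => (hu.2 s hs).symm⟩, ?_⟩
    rintro s (rfl | hs) _
    · exact huv.symm
    · exact (hv.2 s hs).symm
  have := card_le_cliqueNum hclique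
  rw [Finset.card_insert_of_notMem hvuS, Finset.card_insert_of_notMem huS] at this
  omega

namespace IsLeastPosZero

lemma exists_clique_mem_card_eq {r : ℝ} (h : IsLeastPosZero G r)
    (heq : Fintype.card V * r = cliqueNum G) (v : V) :
    ∃ S : Finset V, v ∈ S ∧ G.IsClique (S : Set V) ∧ S.card = cliqueNum G := by
  obtain ⟨S, hS, hmax⟩ := ((cliquesIn G Finset.univ).filter fun S => v ∈ S).exists_max_image
    Finset.card ⟨{v}, by simp [mem_cliquesIn]⟩
  simp only [Finset.mem_filter, mem_cliquesIn, Finset.subset_univ, true_and] at hS hmax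
  refine ⟨S, hS.2, hS.1, (card_le_cliqueNum hS.1).antisymm ?_⟩
  by_contra! hlt
  have h0 := h.altCliqueSum_commonNbrs_eq_zero heq hS.1 hlt
  obtain hE | ⟨w, hw⟩ := (commonNbrsIn G Finset.univ S).eq_empty_or_nonempty
  · simp [hE] at h0
  · rw [mem_commonNbrsIn] at hw
    have hwS : w ∉ S := fun h => G.loopless.irrefl w (hw.2 w h)
    have := hmax (insert w S) ⟨by
      rw [Finset.coe_insert, SimpleGraph.isClique_insert]
      exact ⟨hS.1, fun s hs _ => (hw.2 s hs).symm⟩, Finset.mem_insert_of_mem hS.2⟩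
    rw [Finset.card_insert_of_notMem hwS] at this
    omega

lemma card_nbrsIn_mul {r : ℝ} (h : IsLeastPosZero G r)
    (heq : Fintype.card V * r = cliqueNum G) (v : V) :
    (nbrsIn G Finset.univ v).card * r = cliqueNum G - 1 := by
  have hsum := sum_deficit_eq (G := G) r (cliqueNum G - 1) (nbrsIn G Finset.univ v)
  rw [Finset.sum_eq_zero] at hsum
  · linarith
  intro S hS
  rw [mem_cliquesIn] at hS
  have hvS : v ∉ S := fun h => notMem_nbrsIn _ v (hS.1 h)
  have hclique : G.IsClique (insert v S : Finset V) := by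
    rw [Finset.coe_insert, SimpleGraph.isClique_insert]
    exact ⟨hS.2, fun s hs _ => (mem_nbrsIn.1 (hS.1 hs)).2⟩
  have hle := card_le_cliqueNum hclique
  obtain heq' | hlt := hle.eq_or_lt
  · rw [← heq', Finset.card_insert_of_notMem hvS]
    simp
  · have := h.altCliqueSum_commonNbrs_eq_zero heq hclique hlt
    rw [commonNbrsIn_insert] at this
    rw [this, mul_zero, mul_zero]

lemma card_nonNbrs_mul {r : ℝ} (h : IsLeastPosZero G r)
    (heq : Fintype.card V * r = cliqueNum G) (v : V) :
    (Finset.univ.filter fun w => ¬ G.Adj v w).card * r = 1 := by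
  have hcard := Finset.card_filter_add_card_filter_not (s := Finset.univ) (G.Adj v)
  have hN := h.card_nbrsIn_mul heq v
  have hcard' : ((nbrsIn G Finset.univ v).card : ℝ) +
      (Finset.univ.filter fun w => ¬ G.Adj v w).card = Fintype.card V := by
    exact_mod_cast hcard
  rw [← hcard'] at heq
  linarith

lemma not_adj_trans {r : ℝ} (h : IsLeastPosZero G r)
    (heq : Fintype.card V * r = cliqueNum G) {u v w : V} (hu : ¬ G.Adj v u) (hw : ¬ G.Adj v w) :
    ¬ G.Adj u w := by
  obtain ⟨K, hvK, hK, hcard⟩ := h.exists_clique_mem_card_eq heq v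
  have hS : G.IsClique ((K.erase v : Finset V) : Set V) :=
    hK.subset (Finset.coe_subset.2 (Finset.erase_subset v K))
  have hScard : (K.erase v).card + 1 = cliqueNum G := by
    rw [Finset.card_erase_add_one hvK, hcard]
  have hind := commonNbrsIn_independent hS hScard
  have h0 := h.altCliqueSum_commonNbrs_eq_zero heq hS (by omega)
  rw [altCliqueSum_of_independent r hind, ← h.card_nonNbrs_mul heq v, ← sub_mul,
    mul_eq_zero_iff_right h.pos.ne', sub_eq_zero, Nat.cast_inj] at h0
  have hv : v ∈ commonNbrsIn G Finset.univ (K.erase v) :=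
    mem_commonNbrsIn.2 ⟨Finset.mem_univ v, fun s hs =>
      hK (Finset.mem_of_mem_erase hs) hvK (Finset.ne_of_mem_erase hs)⟩
  have hset := Finset.eq_of_subset_of_card_le
    (s := commonNbrsIn G Finset.univ (K.erase v)) (t := Finset.univ.filter fun w => ¬ G.Adj v w)
    (fun w hw => Finset.mem_filter.2 ⟨Finset.mem_univ w, hind v hv w hw⟩) h0.le
  rw [hset] at hind
  exact hind u (by simpa using hu) w (by simpa using hw)

lemma exists_multipartite [Nonempty V] {r : ℝ} (h : IsLeastPosZero G r)
    (heq : Fintype.card V * r = cliqueNum G) :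
    cliqueNum G ∣ Fintype.card V ∧
      ∃ f : V → Fin (cliqueNum G),
        (∀ i : Fin (cliqueNum G),
          (Finset.univ.filter (fun v => f v = i)).card = Fintype.card V / cliqueNum G) ∧
        (∀ u v : V, G.Adj u v ↔ f u ≠ f v) := by
  have hclass : ∀ v, Fintype.card V =
      cliqueNum G * (Finset.univ.filter fun w => ¬ G.Adj v w).card := by
    intro v
    have h1 := h.card_nonNbrs_mul heq v
    rw [← mul_one (cliqueNum G : ℝ), ← h1, ← mul_assoc] at heq
    exact_mod_cast mul_right_cancel₀ h.pos.ne' heq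
  refine ⟨⟨_, hclass (Classical.arbitrary V)⟩, ?_⟩
  obtain ⟨K, hK, hcard⟩ := exists_clique_card_eq G
  let e : Fin (cliqueNum G) ≃ K := (K.equivFinOfCardEq hcard).symm
  have hadj : ∀ i j, ¬ G.Adj (e i) (e j) → i = j := by
    intro i j hij
    by_contra hne
    exact hij (hK (e i).2 (e j).2 fun h => hne (e.injective (Subtype.ext h)))
  have hex : ∀ u, ∃ i, ¬ G.Adj (e i) u := by
    intro u
    by_contra! hall
    have hall' : ∀ s ∈ K, G.Adj s u := fun s hs => by
      simpa using hall (e.symm ⟨s, hs⟩)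
    have huK : u ∉ K := fun hu => G.loopless.irrefl u (hall' u hu)
    have := card_le_cliqueNum (G := G) (S := insert u K) (by
      rw [Finset.coe_insert, SimpleGraph.isClique_insert]
      exact ⟨hK, fun s hs _ => (hall' s hs).symm⟩)
    rw [Finset.card_insert_of_notMem huK] at this
    omega
  choose f hf using hex
  have hf' : ∀ u i, f u = i ↔ ¬ G.Adj (e i) u := by
    refine fun u i => ⟨fun hi => hi ▸ hf u, fun hi => hadj _ _ ?_⟩
    exact h.not_adj_trans heq (fun h => hf u h.symm) fun h => hi h.symm
  refine ⟨f, fun i => ?_, fun u v => ?_⟩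
  · simp only [hf']
    rw [hclass (e i), Nat.mul_div_cancel_left _ (cliqueNum_pos G)]
  · rw [← not_iff_not, not_not, hf']
    exact ⟨fun huv => h.not_adj_trans heq (fun h => hf v h.symm) fun h => huv h.symm,
      fun huv => h.not_adj_trans heq huv (hf v)⟩

end IsLeastPosZero

lemma IsLeastPosZero.card_mul_eq_of_multipartite [Nonempty V] {r : ℝ} (h : IsLeastPosZero G r)
    (hdvd : cliqueNum G ∣ Fintype.card V) {f : V → Fin (cliqueNum G)}
    (hcard : ∀ i, (Finset.univ.filter (fun v => f v = i)).card = Fintype.card V / cliqueNum G)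
    (hf : ∀ u v : V, G.Adj u v ↔ f u ≠ f v) : Fintype.card V * r = cliqueNum G := by
  have h0 := h.eq_zero
  simp only [altCliqueSum_multipartite hf, hcard, Finset.prod_const] at h0
  have h1 := eq_zero_of_pow_eq_zero h0
  rw [Nat.cast_div hdvd (by exact_mod_cast (cliqueNum_pos G).ne')] at h1
  have hω : (0 : ℝ) < cliqueNum G := by exact_mod_cast cliqueNum_pos G
  field_simp at h1
  linarith

lemma IsLeastPosZero.one_le_card_mul {r : ℝ} (h : IsLeastPosZero G r) :
    1 ≤ Fintype.card V * r := by
  by_contra! hlt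
  have := (altCliqueSum_bounds (G := G) h.pos.le Finset.univ hlt.le).1
  rw [h.eq_zero, Finset.card_univ] at this
  linarith

lemma IsLeastPosZero.card_mul_eq_one_iff {r : ℝ} (h : IsLeastPosZero G r) :
    Fintype.card V * r = 1 ↔ G = ⊥ := by
  constructor
  · intro h1
    by_contra hne
    obtain ⟨u, v, huv⟩ := SimpleGraph.ne_bot_iff_exists_adj.1 hne
    have := one_sub_lt_altCliqueSum h.pos (U := Finset.univ) h1.le (Finset.mem_univ u)
      (Finset.mem_univ v) huv
    rw [h.eq_zero, Finset.card_univ] at this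
    linarith
  · rintro rfl
    have h0 := h.eq_zero
    rw [altCliqueSum_of_independent _ (by simp), Finset.card_univ] at h0
    linarith

lemma IsLeastPosZero.two_mul_le_one {r : ℝ} (h : IsLeastPosZero G r) (hG : G ≠ ⊤) :
    2 * r ≤ 1 := by
  obtain ⟨u, v, hne, huv⟩ := SimpleGraph.ne_top_iff_exists_not_adj.1 hG
  have := h.altCliqueSum_nonneg {u, v}
  rw [altCliqueSum_of_independent _ (by simp [huv, G.adj_comm v u]), Finset.card_pair hne] at this
  push_cast at this
  linarith

end CliqueSums

/-- `n/ω(G) ≤ β(G) ≤ n`; the lower bound is attained iff `ω(G) ∣ n` and `G` is the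
complete multipartite graph with `ω(G)` parts of size `n/ω(G)`; the upper bound is
attained iff `G` is edgeless; and if `G` is not complete and `n > 1` then `β(G) ≥ 2`. -/
theorem stmt_4 {V : Type*} [Fintype V] [Nonempty V] (G : SimpleGraph V) :
    ((Fintype.card V : ℝ) / (cliqueNum G : ℝ) ≤ beta G ∧ beta G ≤ (Fintype.card V : ℝ)) ∧
    (beta G = (Fintype.card V : ℝ) / (cliqueNum G : ℝ) ↔
      cliqueNum G ∣ Fintype.card V ∧
        ∃ f : V → Fin (cliqueNum G),
          (∀ i : Fin (cliqueNum G),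
            (Finset.univ.filter (fun v => f v = i)).card = Fintype.card V / cliqueNum G) ∧
          (∀ u v : V, G.Adj u v ↔ f u ≠ f v)) ∧
    (beta G = (Fintype.card V : ℝ) ↔ G = ⊥) ∧
    (G ≠ ⊤ → 1 < Fintype.card V → 2 ≤ beta G) := by
  obtain ⟨r, h⟩ := exists_isLeastPosZero G
  have hω : (0 : ℝ) < cliqueNum G := by exact_mod_cast cliqueNum_pos G
  have hn : (0 : ℝ) < Fintype.card V := by exact_mod_cast Fintype.card_pos
  rw [h.beta_eq]
  refine ⟨⟨?_, ?_⟩, ?_, ?_, fun hG _ => ?_⟩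
  · rw [div_le_div_iff₀ hω h.pos, one_mul]
    exact h.card_mul_le
  · rw [div_le_iff₀ h.pos]
    exact h.one_le_card_mul
  · rw [div_eq_div_iff h.pos.ne' hω.ne', one_mul, eq_comm]
    exact ⟨fun heq => h.exists_multipartite heq,
      fun ⟨hdvd, _, hcard, hf⟩ => h.card_mul_eq_of_multipartite hdvd hcard hf⟩
  · rw [div_eq_iff h.pos.ne', eq_comm]
    exact h.card_mul_eq_one_iff
  · rw [le_div_iff₀ h.pos]
    exact h.two_mul_le_one hG
end
end
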